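/- For every integer l ≥ 0 the function f'_l(n) = f_l(n)/(q^2;q^2)_n (understood as 0 for n < 0) is an eigenfunction of the operator η_0(M) = t^{−1}U^{−1} + tU − tV^{−2}(U − U^{−1})(q^{−2}U^2 − 1): for all n ∈ ℤ one has (t^{−1} q^{−n} + t q^n) · f'_l(n) − t (q^{n+2} − q^{−n−2})(q^{2n+2} − 1) · f'_l(n+2) = (t q^l + t^{−1} q^{−l}) · f'_l(n). -/

import Mathlib

/-!
STATEMENT 11: For every integer `l ≥ 0` the function `f'_l(n) = f_l(n)/(q²;q²)_n`
(understood as `0` for `n < 0`) is an eigenfunction of the operator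
`η₀(M) = t⁻¹U⁻¹ + tU − tV⁻²(U − U⁻¹)(q⁻²U² − 1)`: for all `n ∈ ℤ`,
`(t⁻¹q^{−n} + t q^n)·f'_l(n) − t(q^{n+2} − q^{−n−2})(q^{2n+2} − 1)·f'_l(n+2)
  = (t q^l + t⁻¹ q^{−l})·f'_l(n)`.

We realize `ℚ(q,t)` as `RatFunc (RatFunc ℚ)` (inner variable `q`, outer variable `t`).
-/

noncomputable section

/-- The field `ℚ(q,t)`. -/
abbrev K : Type := RatFunc (RatFunc ℚ)

/-- The element `q`. -/
def q : K := RatFunc.C RatFunc.X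

/-- The element `t`. -/
def t : K := RatFunc.X

/-- The q-Pochhammer symbol `(a;q²)_m = ∏_{k=0}^{m-1} (1 - (q²)^k a)`. -/
def poch (a : K) (m : ℕ) : K := ∏ k ∈ Finset.range m, (1 - (q ^ 2) ^ k * a)

/-- The eigenfunction `f_l` of the mutated operator. -/
def f (l : ℕ) (n : ℤ) : K :=
  if 0 ≤ n ∧ n ≤ (l : ℤ) ∧ ((l : ℤ) - n) % 2 = 0 then
    poch (q ^ 2) l * (q * t⁻¹) ^ (n - (l : ℤ)) /
      (poch (t ^ 2 * q ^ (n + (l : ℤ))) (((l : ℤ) - n).toNat / 2)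
        * poch (q ^ (n - (l : ℤ))) (((l : ℤ) - n).toNat / 2))
  else 0

/-- The function `f'_l(n) = f_l(n)/(q²;q²)_n` for `n ≥ 0`, and `0` for `n < 0`. -/
def f' (l : ℕ) (n : ℤ) : K :=
  if 0 ≤ n then f l n / poch (q ^ 2) n.toNat else 0

lemma q_ne_zero : q ≠ 0 := by
  unfold q
  simp [RatFunc.X_ne_zero]

lemma t_ne_zero : t ≠ 0 := RatFunc.X_ne_zero

lemma ratX_pow_ne_one {F : Type*} [Field F] (c : F) (k : ℕ) (hk : k ≠ 0) :
    (RatFunc.X : RatFunc F) ^ k ≠ RatFunc.C c := by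
  intro h
  rw [← RatFunc.algebraMap_X, ← RatFunc.algebraMap_C, ← map_pow] at h
  have h2 := RatFunc.algebraMap_injective F h
  have h3 := congrArg Polynomial.natDegree h2
  simp at h3
  exact hk h3

lemma q_pow_ne_one (k : ℕ) (hk : k ≠ 0) : q ^ k ≠ 1 := by
  intro h
  unfold q at h
  rw [← map_pow, ← map_one (RatFunc.C : RatFunc ℚ →+* K)] at h
  have h2 := (RatFunc.C : RatFunc ℚ →+* K).injective h
  rw [← map_one (RatFunc.C : ℚ →+* RatFunc ℚ)] at h2
  exact ratX_pow_ne_one 1 k hk h2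

lemma q_zpow_ne_one (k : ℤ) (hk : k ≠ 0) : q ^ k ≠ 1 := by
  rcases Int.natAbs_eq k with h | h
  · rw [h, zpow_natCast]
    exact q_pow_ne_one _ (by omega)
  · rw [h, zpow_neg, zpow_natCast, Ne, inv_eq_one]
    exact q_pow_ne_one _ (by omega)

lemma one_sub_t_ne (k : ℤ) : 1 - t ^ 2 * q ^ k ≠ 0 := by
  intro h
  have h1 : t ^ 2 = q ^ (-k) := by
    have := zpow_ne_zero k q_ne_zero
    rw [zpow_neg]
    field_simp
    linear_combination -h
  unfold t q at h1
  rw [← map_zpow₀] at h1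
  exact ratX_pow_ne_one _ 2 (by norm_num) h1

lemma poch_succ_left (a : K) (m : ℕ) : poch a (m + 1) = (1 - a) * poch (q ^ 2 * a) m := by
  unfold poch
  rw [Finset.prod_range_succ']
  rw [mul_comm]
  congr 1
  · simp
  · refine Finset.prod_congr rfl fun k _ => ?_
    ring

lemma poch_succ (a : K) (m : ℕ) : poch a (m + 1) = poch a m * (1 - (q ^ 2) ^ m * a) := by
  unfold poch
  rw [Finset.prod_range_succ]

lemma poch_succ_right_shift (a b : K) (m : ℕ) (h : b = q ^ 2 * a) :
    poch a (m + 1) = (1 - a) * poch b m := by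
  rw [h, poch_succ_left]

/-- The main two-step recursion. -/
lemma f'_step (n m : ℕ) :
    f' (n + 2 * (m + 1)) ((n : ℤ) + 2) * ((1 - q ^ (2 * n + 2)) * (1 - q ^ (2 * n + 4)))
      = f' (n + 2 * (m + 1)) n * (q ^ 2 * (t ^ 2)⁻¹ *
        (1 - t ^ 2 * q ^ (2 * n + 2 * m + 2)) * (1 - (q ^ (2 * m + 2))⁻¹)) := by
  have hq := q_ne_zero
  have ht := t_ne_zero
  have e1 : (1 - q ^ (2 * n + 2)) ≠ 0 := sub_ne_zero.2 (q_pow_ne_one _ (by omega)).symm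
  have e2 : (1 - q ^ (2 * n + 4)) ≠ 0 := sub_ne_zero.2 (q_pow_ne_one _ (by omega)).symm
  have e3 : 1 - t ^ 2 * q ^ (2 * n + 2 * m + 2) ≠ 0 := by
    have := one_sub_t_ne ((2 * n + 2 * m + 2 : ℕ) : ℤ)
    rwa [zpow_natCast] at this
  have e4 : 1 - (q ^ (2 * m + 2))⁻¹ ≠ 0 := by
    refine sub_ne_zero.2 (Ne.symm ?_)
    rw [Ne, inv_eq_one]
    exact q_pow_ne_one _ (by omega)
  have a1 : q ^ ((n : ℤ) + ((n + 2 * (m + 1) : ℕ) : ℤ)) = q ^ (2 * n + 2 * m + 2) := by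
    rw [← zpow_natCast]; congr 1; push_cast; ring
  have a2 : q ^ ((n : ℤ) - ((n + 2 * (m + 1) : ℕ) : ℤ)) = (q ^ (2 * m + 2))⁻¹ := by
    rw [← zpow_natCast, ← zpow_neg]; congr 1; push_cast; ring
  have a3 : q ^ ((n : ℤ) + 2 + ((n + 2 * (m + 1) : ℕ) : ℤ)) = q ^ 2 * q ^ (2 * n + 2 * m + 2) := by
    rw [← pow_add, ← zpow_natCast]; congr 1; push_cast; ring
  have a4 : q ^ ((n : ℤ) + 2 - ((n + 2 * (m + 1) : ℕ) : ℤ)) = q ^ 2 * (q ^ (2 * m + 2))⁻¹ := by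
    rw [← a2, ← zpow_natCast, ← zpow_add₀ hq]; congr 1; push_cast; ring
  have a5 : (q * t⁻¹) ^ ((n : ℤ) + 2 - ((n + 2 * (m + 1) : ℕ) : ℤ))
      = (q ^ 2 * (t ^ 2)⁻¹) * (q * t⁻¹) ^ ((n : ℤ) - ((n + 2 * (m + 1) : ℕ) : ℤ)) := by
    have : q ^ 2 * (t ^ 2)⁻¹ = (q * t⁻¹) ^ (2 : ℤ) := by
      rw [zpow_ofNat]; ring
    rw [this, ← zpow_add₀ (mul_ne_zero hq (inv_ne_zero ht))]; congr 1; ring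
  have b1 : (((n + 2 * (m + 1) : ℕ) : ℤ) - (n : ℤ)).toNat / 2 = m + 1 := by omega
  have b2 : (((n + 2 * (m + 1) : ℕ) : ℤ) - ((n : ℤ) + 2)).toNat / 2 = m := by omega
  have b3 : ((n : ℤ) + 2).toNat = n + 1 + 1 := by omega
  have b4 : ((n : ℤ)).toNat = n := by omega
  have c1 : 0 ≤ (n : ℤ) + 2 := by omega
  have c2 : 0 ≤ (n : ℤ) := by omega
  unfold f' f
  rw [if_pos c1, if_pos c2, if_pos (by omega), if_pos (by omega), a1, a2, a3, a4, a5, b1, b2, b3,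
    b4, poch_succ (q ^ 2) (n + 1), poch_succ (q ^ 2) n, poch_succ_left, poch_succ_left]
  have d1 : 1 - (q ^ 2) ^ n * q ^ 2 = 1 - q ^ (2 * n + 2) := by ring
  have d2 : 1 - (q ^ 2) ^ (n + 1) * q ^ 2 = 1 - q ^ (2 * n + 4) := by ring
  have d3 : t ^ 2 * (q ^ 2 * q ^ (2 * n + 2 * m + 2)) =
    q ^ 2 * (t ^ 2 * q ^ (2 * n + 2 * m + 2)) := by ring
  rw [d1, d2, d3]
  generalize poch (q ^ 2 * (t ^ 2 * q ^ (2 * n + 2 * m + 2))) m = P1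
  generalize poch (q ^ 2 * (q ^ (2 * m + 2))⁻¹) m = P2
  generalize poch (q ^ 2) n = P3
  generalize poch (q ^ 2) (n + 2 * (m + 1)) = P4
  generalize (q * t⁻¹) ^ ((n : ℤ) - ((n + 2 * (m + 1) : ℕ) : ℤ)) = P5
  generalize q ^ 2 * (t ^ 2)⁻¹ = P6
  generalize (1 - q ^ (2 * n + 2)) = E1 at *
  generalize (1 - q ^ (2 * n + 4)) = E2 at *
  generalize 1 - t ^ 2 * q ^ (2 * n + 2 * m + 2) = E3 at *
  generalize 1 - (q ^ (2 * m + 2))⁻¹ = E4 at *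
  simp only [div_eq_mul_inv, mul_inv]
  have i1 := mul_inv_cancel₀ e1
  have i2 := mul_inv_cancel₀ e2
  have i3 := mul_inv_cancel₀ e3
  have i4 := mul_inv_cancel₀ e4
  calc _ = P4 * P5 * P6 * P1⁻¹ * P2⁻¹ * P3⁻¹ * (E1 * E1⁻¹) * (E2 * E2⁻¹) := by ring
    _ = P4 * P5 * P6 * P1⁻¹ * P2⁻¹ * P3⁻¹ * (E3 * E3⁻¹) * (E4 * E4⁻¹) := by
      rw [i1, i2, i3, i4]
    _ = _ := by ring

lemma f'_zero_of (l : ℕ) (n : ℤ) (h : ¬ (0 ≤ n ∧ n ≤ (l : ℤ) ∧ ((l : ℤ) - n) % 2 = 0)) :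
    f' l n = 0 := by
  unfold f' f
  rw [if_neg h]
  simp

/-- The eigenfunction equation for `η₀(M) = t⁻¹U⁻¹ + tU − tV⁻²(U − U⁻¹)(q⁻²U² − 1)`. -/
theorem eta0_macdonald_eigenfunction (l : ℕ) (n : ℤ) :
    (t⁻¹ * q ^ (-n) + t * q ^ n) * f' l n
        - t * (q ^ (n + 2) - q ^ (-n - 2)) * (q ^ (2 * n + 2) - 1) * f' l (n + 2)
      = (t * q ^ (l : ℤ) + t⁻¹ * q ^ (-(l : ℤ))) * f' l n := by
  have hq := q_ne_zero
  have ht := t_ne_zero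
  by_cases h : 0 ≤ n ∧ n ≤ (l : ℤ) ∧ ((l : ℤ) - n) % 2 = 0
  · obtain ⟨h0, h1, h2⟩ := h
    obtain ⟨k, rfl⟩ := Int.eq_ofNat_of_zero_le h0
    by_cases hl : (k : ℤ) = l
    · rw [f'_zero_of l ((k : ℤ) + 2) (by omega), hl]
      ring
    · obtain ⟨m, rfl⟩ : ∃ m, l = k + 2 * (m + 1) := ⟨(l - k) / 2 - 1, by omega⟩
      have hs := f'_step k m
      have g1 : q ^ ((k : ℤ) + 2) = q ^ k * q ^ 2 := by
        rw [← pow_add, ← zpow_natCast]; congr 1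
      have g2 : q ^ (-(k : ℤ) - 2) = (q ^ k * q ^ 2)⁻¹ := by
        rw [← g1, ← zpow_neg]; congr 1; ring
      have g3 : q ^ (2 * (k : ℤ) + 2) = q ^ (2 * k + 2) := by
        rw [← zpow_natCast]; congr 1
      rw [g1, g2, g3, zpow_neg, zpow_neg, zpow_natCast, zpow_natCast]
      have key : t * (q ^ k * q ^ 2 - (q ^ k * q ^ 2)⁻¹) * (q ^ (2 * k + 2) - 1)
          = t * (q ^ k * q ^ 2)⁻¹ * ((1 - q ^ (2 * k + 2)) * (1 - q ^ (2 * k + 4))) := by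
        field_simp
        ring
      rw [key, mul_assoc, mul_comm ((1 - q ^ (2 * k + 2)) * _), hs]
      generalize f' (k + 2 * (m + 1)) k = F
      field_simp
      ring
  · rw [f'_zero_of l n h]
    by_cases h' : 0 ≤ n + 2 ∧ n + 2 ≤ (l : ℤ) ∧ ((l : ℤ) - (n + 2)) % 2 = 0
    · obtain rfl | rfl : n = -1 ∨ n = -2 := by omega
      · norm_num
      · norm_num
    · rw [f'_zero_of l _ h']
      ring

end
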